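/- Let C be a closed symmetric monoidal category with tensor unit 𝟙, and let (A, m, u) be a monoid object in C such that the iterated canonical pairing maps μ_n(A) : (A^∨)^{⊗n} → (A^{⊗n})^∨ are isomorphisms for all n ≥ 0 (i.e., A is weak quasi-proper). Then the linear dual A^∨ is a comonoid object in C, with comultiplication given by the composite A^∨ → (A ⊗ A)^∨ → A^∨ ⊗ A^∨ of m^∨ with the inverse of the canonical pairing map μ_{A,A}, and counit given by the composite A^∨ → 𝟙^∨ → 𝟙 of u^∨ with the inverse of the canonical isomorphism μ_0 : 𝟙 → 𝟙^∨; that is, these maps satisfy the coassociativity and counit axioms of a comonoid object. (1-categorical version of the paper's Proposition that the dual of a weak quasi-proper algebra is a coalgebra.) -/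

import Mathlib

set_option linter.unusedSectionVars false

open CategoryTheory MonoidalCategory MonoidalClosed

universe v u

namespace CoTHHFormal

variable (C : Type u) [Category.{v} C] [MonoidalCategory C] [SymmetricCategory C]
  [MonoidalClosed C]

/-- The linear dual of an object: `X^∨ = [X, 𝟙]`. -/
def dual (X : C) : C := (ihom X).obj (𝟙_ C)

variable {C}

/-- The linear dual of a morphism, acting contravariantly by precomposition in the
internal hom. -/
def dualMap {X Y : C} (f : X ⟶ Y) : dual C Y ⟶ dual C X :=
  (MonoidalClosed.pre f).app (𝟙_ C)

@[simp] lemma dualMap_id (X : C) : dualMap (𝟙 X) = 𝟙 (dual C X) := by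
  simp [dualMap, dual]

@[simp] lemma dualMap_comp {X Y Z : C} (f : X ⟶ Y) (g : Y ⟶ Z) :
    dualMap (f ≫ g) = dualMap g ≫ dualMap f := by
  simp [dualMap]
  rfl

variable (C)

/-- The evaluation map `X ⊗ X^∨ ⟶ 𝟙`. -/
def ev (X : C) : X ⊗ dual C X ⟶ 𝟙_ C := (ihom.ev X).app (𝟙_ C)

/-- The canonical map `η_X : X ⟶ X^∨∨`, adjoint under the tensor-hom adjunction to the
composite `X^∨ ⊗ X ≅ X ⊗ X^∨ → 𝟙` of the symmetry with the evaluation map. -/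
def eta (X : C) : X ⟶ dual C (dual C X) :=
  MonoidalClosed.curry ((β_ (dual C X) X).hom ≫ ev C X)

/-- The canonical pairing map `μ_{X,Y} : X^∨ ⊗ Y^∨ ⟶ (X ⊗ Y)^∨`, adjoint to the composite
of the symmetry rearrangement with the two evaluation maps. -/
def pairing (X Y : C) : dual C X ⊗ dual C Y ⟶ dual C (X ⊗ Y) :=
  MonoidalClosed.curry
    (tensorμ X Y (dual C X) (dual C Y) ≫ (ev C X ⊗ₘ ev C Y) ≫ (λ_ (𝟙_ C)).hom)

/-- The canonical map `μ_0 : 𝟙 ⟶ 𝟙^∨`. -/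
def pairingUnit : 𝟙_ C ⟶ dual C (𝟙_ C) :=
  MonoidalClosed.curry (λ_ (𝟙_ C)).hom

/-- Tensor powers of an object: `X^{⊗0} = 𝟙` and `X^{⊗(n+1)} = X^{⊗n} ⊗ X`. -/
def tpow (X : C) : ℕ → C
  | 0 => 𝟙_ C
  | n + 1 => tpow X n ⊗ X

/-- The iterated canonical pairing maps `μ_n(X) : (X^∨)^{⊗n} ⟶ (X^{⊗n})^∨`,
the lax monoidal structure maps of the linear dual functor. -/
def pairingPow (X : C) : (n : ℕ) → (tpow C (dual C X) n ⟶ dual C (tpow C X n))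
  | 0 => pairingUnit C
  | n + 1 => (pairingPow X n ▷ dual C X) ≫ pairing C (tpow C X n) X

/-- An object is dualizable if it admits an exact pairing with some object. -/
def Dualizable (X : C) : Prop := ∃ Y : C, Nonempty (ExactPairing X Y)

variable {C}

lemma dual_hom_ext {W Z : C} {f g : W ⟶ dual C Z} (h : Z ◁ f ≫ ev C Z = Z ◁ g ≫ ev C Z) :
    f = g :=
  MonoidalClosed.uncurry_injective h

lemma whiskerLeft_dualMap_ev {X Y : C} (f : X ⟶ Y) :
    X ◁ dualMap f ≫ ev C X = f ▷ dual C Y ≫ ev C Y :=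
  MonoidalClosed.id_tensor_pre_app_comp_ev f (𝟙_ C)

lemma whiskerLeft_pairing_ev (X Y : C) :
    (X ⊗ Y) ◁ pairing C X Y ≫ ev C (X ⊗ Y) =
      tensorμ X Y (dual C X) (dual C Y) ≫ (ev C X ⊗ₘ ev C Y) ≫ (λ_ (𝟙_ C)).hom :=
  MonoidalClosed.whiskerLeft_curry_ihom_ev_app _ _ _

lemma whiskerLeft_pairingUnit_ev :
    𝟙_ C ◁ pairingUnit C ≫ ev C (𝟙_ C) = (λ_ (𝟙_ C)).hom :=
  MonoidalClosed.whiskerLeft_curry_ihom_ev_app _ _ _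

/-- The pairing maps are natural in both variables. -/
lemma pairing_naturality {X X' Y Y' : C} (f : X ⟶ X') (g : Y ⟶ Y') :
    (dualMap f ⊗ₘ dualMap g) ≫ pairing C X Y = pairing C X' Y' ≫ dualMap (f ⊗ₘ g) := by
  apply dual_hom_ext
  rw [whiskerLeft_comp, Category.assoc, whiskerLeft_pairing_ev, tensorμ_natural_right_assoc,
    tensorHom_comp_tensorHom_assoc, whiskerLeft_dualMap_ev, whiskerLeft_dualMap_ev,
    whiskerLeft_comp, Category.assoc, whiskerLeft_dualMap_ev, whisker_exchange_assoc,
    whiskerLeft_pairing_ev, tensorμ_natural_left_assoc, tensorHom_comp_tensorHom_assoc]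

lemma pairing_naturality_left {X X' : C} (f : X ⟶ X') (Y : C) :
    dualMap f ▷ dual C Y ≫ pairing C X Y = pairing C X' Y ≫ dualMap (f ▷ Y) := by
  simpa using pairing_naturality f (𝟙 Y)

lemma pairing_naturality_right (X : C) {Y Y' : C} (g : Y ⟶ Y') :
    dual C X ◁ dualMap g ≫ pairing C X Y = pairing C X Y' ≫ dualMap (X ◁ g) := by
  simpa using pairing_naturality (𝟙 X) g

lemma pairing_left_unitality (X : C) :
    pairingUnit C ▷ dual C X ≫ pairing C (𝟙_ C) X = (λ_ (dual C X)).hom ≫ dualMap (λ_ X).hom := by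
  apply dual_hom_ext
  have h : (𝟙_ C ⊗ X) ◁ (pairingUnit C ▷ dual C X) =
      (𝟙_ C ⊗ X) ◁ (pairingUnit C ⊗ₘ 𝟙 (dual C X)) := by simp
  rw [whiskerLeft_comp, Category.assoc, whiskerLeft_pairing_ev, h, tensorμ_natural_right_assoc,
    tensorHom_comp_tensorHom_assoc, whiskerLeft_pairingUnit_ev, whiskerLeft_id, Category.id_comp,
    whiskerLeft_comp, Category.assoc, whiskerLeft_dualMap_ev, ← tensorHom_def'_assoc,
    leftUnitor_monoidal]
  simp [MonoidalCategory.tensorHom_def]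

lemma pairing_right_unitality (X : C) :
    dual C X ◁ pairingUnit C ≫ pairing C X (𝟙_ C) = (ρ_ (dual C X)).hom ≫ dualMap (ρ_ X).hom := by
  apply dual_hom_ext
  have h : (X ⊗ 𝟙_ C) ◁ (dual C X ◁ pairingUnit C) =
      (X ⊗ 𝟙_ C) ◁ (𝟙 (dual C X) ⊗ₘ pairingUnit C) := by simp
  rw [whiskerLeft_comp, Category.assoc, whiskerLeft_pairing_ev, h, tensorμ_natural_right_assoc,
    tensorHom_comp_tensorHom_assoc, whiskerLeft_pairingUnit_ev, whiskerLeft_id, Category.id_comp,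
    whiskerLeft_comp, Category.assoc, whiskerLeft_dualMap_ev, ← tensorHom_def'_assoc,
    rightUnitor_monoidal]
  simp [tensorHom_def', unitors_equal]

lemma pairing_associativity (X Y Z : C) :
    pairing C X Y ▷ dual C Z ≫ pairing C (X ⊗ Y) Z =
      (α_ (dual C X) (dual C Y) (dual C Z)).hom ≫ dual C X ◁ pairing C Y Z ≫
        pairing C X (Y ⊗ Z) ≫ dualMap (α_ X Y Z).hom := by
  apply dual_hom_ext
  have h₁ : ((X ⊗ Y) ⊗ Z) ◁ (pairing C X Y ▷ dual C Z) =
      ((X ⊗ Y) ⊗ Z) ◁ (pairing C X Y ⊗ₘ 𝟙 (dual C Z)) := by simp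
  have h₂ : (X ⊗ Y ⊗ Z) ◁ (dual C X ◁ pairing C Y Z) =
      (X ⊗ Y ⊗ Z) ◁ (𝟙 (dual C X) ⊗ₘ pairing C Y Z) := by simp
  have hl : (tensorμ X Y (dual C X) (dual C Y) ≫ (ev C X ⊗ₘ ev C Y) ≫ (λ_ (𝟙_ C)).hom) ⊗ₘ ev C Z =
      tensorμ X Y (dual C X) (dual C Y) ▷ (Z ⊗ dual C Z) ≫ ((ev C X ⊗ₘ ev C Y) ⊗ₘ ev C Z) ≫
        (λ_ (𝟙_ C)).hom ▷ 𝟙_ C := by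
    simp only [← tensorHom_id, tensorHom_comp_tensorHom, Category.id_comp, Category.comp_id]
  have hr : ev C X ⊗ₘ (tensorμ Y Z (dual C Y) (dual C Z) ≫ (ev C Y ⊗ₘ ev C Z) ≫ (λ_ (𝟙_ C)).hom) =
      (X ⊗ dual C X) ◁ tensorμ Y Z (dual C Y) (dual C Z) ≫ (ev C X ⊗ₘ ev C Y ⊗ₘ ev C Z) ≫
        𝟙_ C ◁ (λ_ (𝟙_ C)).hom := by
    simp only [← id_tensorHom, tensorHom_comp_tensorHom, Category.id_comp, Category.comp_id]
  have hα : (α_ (𝟙_ C) (𝟙_ C) (𝟙_ C)).hom ≫ 𝟙_ C ◁ (λ_ (𝟙_ C)).hom ≫ (λ_ (𝟙_ C)).hom =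
      (λ_ (𝟙_ C)).hom ▷ 𝟙_ C ≫ (λ_ (𝟙_ C)).hom := by monoidal
  calc
    _ = tensorμ (X ⊗ Y) Z (dual C X ⊗ dual C Y) (dual C Z) ≫
        tensorμ X Y (dual C X) (dual C Y) ▷ (Z ⊗ dual C Z) ≫ ((ev C X ⊗ₘ ev C Y) ⊗ₘ ev C Z) ≫
          (λ_ (𝟙_ C)).hom ▷ 𝟙_ C ≫ (λ_ (𝟙_ C)).hom := by
      rw [whiskerLeft_comp, Category.assoc, whiskerLeft_pairing_ev, h₁,
        tensorμ_natural_right_assoc, tensorHom_comp_tensorHom_assoc, whiskerLeft_pairing_ev,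
        whiskerLeft_id, Category.id_comp, hl]
      simp only [Category.assoc]
    _ = ((α_ X Y Z).hom ⊗ₘ (α_ (dual C X) (dual C Y) (dual C Z)).hom) ≫
        tensorμ X (Y ⊗ Z) (dual C X) (dual C Y ⊗ dual C Z) ≫
          (X ⊗ dual C X) ◁ tensorμ Y Z (dual C Y) (dual C Z) ≫
            (ev C X ⊗ₘ ev C Y ⊗ₘ ev C Z) ≫ 𝟙_ C ◁ (λ_ (𝟙_ C)).hom ≫ (λ_ (𝟙_ C)).hom := by
      rw [← associator_monoidal_assoc, ← associator_naturality_assoc, hα]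
    _ = _ := by
      simp only [whiskerLeft_comp, Category.assoc]
      rw [whiskerLeft_dualMap_ev, whisker_exchange_assoc, whisker_exchange_assoc,
        whiskerLeft_pairing_ev, h₂, tensorμ_natural_right_assoc, tensorHom_comp_tensorHom_assoc,
        whiskerLeft_pairing_ev, whiskerLeft_id, Category.id_comp, hr, ← tensorHom_def'_assoc]
      simp only [Category.assoc]

instance isIso_dualMap {X Y : C} (f : X ⟶ Y) [IsIso f] : IsIso (dualMap f) :=
  ⟨dualMap (inv f), by simp [← dualMap_comp], by simp [← dualMap_comp]⟩

lemma isIso_pairing_left_iff {X X' : C} (f : X ⟶ X') [IsIso f] (Y : C) :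
    IsIso (pairing C X Y) ↔ IsIso (pairing C X' Y) := by
  rw [← isIso_comp_left_iff (dualMap f ▷ dual C Y), pairing_naturality_left,
    isIso_comp_right_iff]

lemma isIso_pairing_tpow (X : C) (h : ∀ n : ℕ, IsIso (pairingPow C X n)) (n : ℕ) :
    IsIso (pairing C (tpow C X n) X) := by
  have := h n
  have h' : IsIso (pairingPow C X n ▷ dual C X ≫ pairing C (tpow C X n) X) := h (n + 1)
  exact (isIso_comp_left_iff _ _).1 h'

lemma isIso_pairing_self (X : C) (h : ∀ n : ℕ, IsIso (pairingPow C X n)) :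
    IsIso (pairing C X X) :=
  (isIso_pairing_left_iff (λ_ X).hom X).1 (isIso_pairing_tpow X h 1)

lemma isIso_pairing_tensor_self (X : C) (h : ∀ n : ℕ, IsIso (pairingPow C X n)) :
    IsIso (pairing C X (X ⊗ X)) := by
  have := isIso_pairing_self X h
  have h₁ : IsIso (pairing C (X ⊗ X) X) :=
    (isIso_pairing_left_iff ((λ_ X).hom ▷ X) X).1 (isIso_pairing_tpow X h 2)
  have h₂ : IsIso (pairing C X X ▷ dual C X ≫ pairing C (X ⊗ X) X) := inferInstance
  rw [pairing_associativity, isIso_comp_left_iff, isIso_comp_left_iff,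
    isIso_comp_right_iff] at h₂
  exact h₂

variable (C)

/-- If `(A, m, u)` is a monoid object which is weak quasi-proper (all iterated canonical
pairing maps `μ_n(A)` are isomorphisms), then `A^∨` is a comonoid object, with
comultiplication `m^∨ ≫ μ_{A,A}⁻¹` and counit `u^∨ ≫ μ_0⁻¹`: the pairing maps `μ_{A,A}`
and `μ_0` are invertible and the resulting structure maps satisfy the counit and
coassociativity axioms of a comonoid object. -/
theorem dual_of_weak_quasi_proper_monoid_is_comonoid (M : Mon C)
    (h : ∀ n : ℕ, IsIso (pairingPow C M.X n)) :
    ∃ (p : dual C (M.X ⊗ M.X) ⟶ dual C M.X ⊗ dual C M.X)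
      (q : dual C (𝟙_ C) ⟶ 𝟙_ C),
      pairing C M.X M.X ≫ p = 𝟙 (dual C M.X ⊗ dual C M.X) ∧
      p ≫ pairing C M.X M.X = 𝟙 (dual C (M.X ⊗ M.X)) ∧
      pairingUnit C ≫ q = 𝟙 (𝟙_ C) ∧
      q ≫ pairingUnit C = 𝟙 (dual C (𝟙_ C)) ∧
      (let Δ : dual C M.X ⟶ dual C M.X ⊗ dual C M.X := dualMap M.mon.mul ≫ p
       let ε : dual C M.X ⟶ 𝟙_ C := dualMap M.mon.one ≫ q
       Δ ≫ (ε ▷ dual C M.X) = (λ_ (dual C M.X)).inv ∧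
       Δ ≫ (dual C M.X ◁ ε) = (ρ_ (dual C M.X)).inv ∧
       Δ ≫ (dual C M.X ◁ Δ) =
         Δ ≫ (Δ ▷ dual C M.X) ≫ (α_ (dual C M.X) (dual C M.X) (dual C M.X)).hom) := by
  have : IsIso (pairingUnit C) := h 0
  have := isIso_pairing_self M.X h
  have := isIso_pairing_tensor_self M.X h
  refine ⟨inv (pairing C M.X M.X), inv (pairingUnit C), by simp, by simp, by simp, by simp,
    ?_, ?_, ?_⟩
  · rw [← cancel_mono ((λ_ (dual C M.X)).hom ≫ dualMap (λ_ M.X).hom), Iso.inv_hom_id_assoc,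
      ← pairing_left_unitality]
    simp only [Category.assoc, comp_whiskerRight, inv_hom_whiskerRight'_assoc]
    rw [pairing_naturality_left, IsIso.inv_hom_id_assoc, ← dualMap_comp, MonObj.one_mul]
  · rw [← cancel_mono ((ρ_ (dual C M.X)).hom ≫ dualMap (ρ_ M.X).hom), Iso.inv_hom_id_assoc,
      ← pairing_right_unitality]
    simp only [Category.assoc, whiskerLeft_comp, whiskerLeft_inv_hom'_assoc]
    rw [pairing_naturality_right, IsIso.inv_hom_id_assoc, ← dualMap_comp, MonObj.mul_one]
  · rw [← cancel_mono (dual C M.X ◁ pairing C M.X M.X ≫ pairing C M.X (M.X ⊗ M.X) ≫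
      dualMap (α_ M.X M.X M.X).hom)]
    simp only [Category.assoc]
    rw [← pairing_associativity]
    simp only [Category.assoc, whiskerLeft_comp, comp_whiskerRight, inv_hom_whiskerRight'_assoc,
      whiskerLeft_inv_hom'_assoc]
    rw [pairing_naturality_left, ← Category.assoc (dual C M.X ◁ dualMap M.mon.mul),
      pairing_naturality_right, Category.assoc, IsIso.inv_hom_id_assoc,
      IsIso.inv_hom_id_assoc, ← dualMap_comp, ← dualMap_comp, ← dualMap_comp,
      MonObj.mul_assoc, Category.assoc]

end CoTHHFormal
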